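/- arXiv:1709.10314 — 3 statements merged into one kernel-verified Lean document; each statement's English description precedes it below -/
import Mathlib

section
/- For μ ∈ ℂ such that 1−μ is not a nonpositive integer, λ ∈ ℂ and z ∈ (−1,1), define P^μ_λ(z) := (1/Γ(1−μ)) ((1+z)/(1−z))^{μ/2} ₂F₁(−λ, λ+1; 1−μ; (1−z)/2). Then for every m ∈ ℕ₀, every λ ∈ ℂ and every z ∈ (−1,1), P^μ_λ(z) converges to P^m_λ(z) = ((−λ)_m (1+λ)_m / m!) ((1−z)/(1+z))^{m/2} ₂F₁(−λ, λ+1; 1+m; (1−z)/2) as μ → m along μ for which 1−μ is not a nonpositive integer. -/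
open scoped BigOperators

/-- The Gauss hypergeometric function `₂F₁(a,b;c;x)` as a power series. -/
noncomputable def hyp2F1 (a b c x : ℂ) : ℂ :=
  ∑' n : ℕ, ((ascPochhammer ℂ n).eval a * (ascPochhammer ℂ n).eval b /
    ((ascPochhammer ℂ n).eval c * (n.factorial : ℂ))) * x ^ n

/-- The associated Legendre function `P^m_λ` of general degree `λ` and order `m ∈ ℕ`. -/
noncomputable def PLeg (m : ℕ) (lam : ℂ) (z : ℝ) : ℂ :=
  ((ascPochhammer ℂ m).eval (-lam) * (ascPochhammer ℂ m).eval (1 + lam) / (m.factorial : ℂ)) *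
    (((1 - z) / (1 + z) : ℂ)) ^ ((m : ℂ) / 2) *
    hyp2F1 (-lam) (lam + 1) (1 + (m : ℂ)) (((1 - z) / 2 : ℝ) : ℂ)

/-- The associated Legendre function `P^μ_λ` of general degree `λ` and general order `μ`. -/
noncomputable def PGen (μ lam : ℂ) (z : ℝ) : ℂ :=
  (Complex.Gamma (1 - μ))⁻¹ * (((1 + z) / (1 - z) : ℂ)) ^ (μ / 2) *
    hyp2F1 (-lam) (lam + 1) (1 - μ) (((1 - z) / 2 : ℝ) : ℂ)

namespace Complex

open Filter Topology PowerSeries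

/-- The hypergeometric differential equation for a formal power series, written with the operator
`X d/dX`, is equivalent to the two-term recurrence for its coefficients. -/
theorem hypergeometric_ode_iff {a b c : ℂ} {f : PowerSeries ℂ} :
    d⁄dX ℂ (X * d⁄dX ℂ f) + C (c - 1) * d⁄dX ℂ f =
        X * d⁄dX ℂ (X * d⁄dX ℂ f) + C (a + b) * (X * d⁄dX ℂ f) + C (a * b) * f ↔
      ∀ n : ℕ, (n + 1) * (c + n) * coeff (n + 1) f = (a + n) * (b + n) * coeff n f := by
  have coeff_euler (g : PowerSeries ℂ) (n : ℕ) : coeff n (X * d⁄dX ℂ g) = n * coeff n g := by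
    cases n with
    | zero => simp
    | succ n => simp [coeff_succ_X_mul, coeff_derivative, mul_comm]
  rw [PowerSeries.ext_iff]
  refine forall_congr' fun n ↦ ?_
  simp only [LinearMap.map_add, coeff_C_mul, coeff_derivative, coeff_euler, Nat.cast_succ]
  constructor <;> intro h <;> linear_combination h

/-- Multiplication by `(1 - X) ^ n` maps solutions of the hypergeometric equation with parameters
`a + n, b + n, a + b + n` to solutions with parameters `a, b, a + b + n`. -/
theorem hypergeometric_ode_one_sub_X_pow_mul {a b : ℂ} {n : ℕ} {f : PowerSeries ℂ}
    (hf : d⁄dX ℂ (X * d⁄dX ℂ f) + C (a + b + n - 1) * d⁄dX ℂ f =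
      X * d⁄dX ℂ (X * d⁄dX ℂ f) + C (a + n + (b + n)) * (X * d⁄dX ℂ f) +
        C ((a + n) * (b + n)) * f) :
    d⁄dX ℂ (X * d⁄dX ℂ ((1 - X) ^ n * f)) + C (a + b + n - 1) * d⁄dX ℂ ((1 - X) ^ n * f) =
      X * d⁄dX ℂ (X * d⁄dX ℂ ((1 - X) ^ n * f)) + C (a + b) * (X * d⁄dX ℂ ((1 - X) ^ n * f)) +
        C (a * b) * ((1 - X) ^ n * f) := by
  have hu : (1 - X) * d⁄dX ℂ ((1 - X) ^ n) = -(n : PowerSeries ℂ) * (1 - X) ^ n := by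
    cases n with
    | zero => simp
    | succ n => simp [Derivation.leibniz_pow]; ring
  set u : PowerSeries ℂ := (1 - X) ^ n
  have hu' := congrArg (d⁄dX ℂ) hu
  simp only [Derivation.leibniz, map_add, map_sub, map_mul, map_neg, map_one, smul_eq_mul,
    derivative_X, map_natCast, Derivation.map_natCast, Derivation.map_one_eq_zero]
    at hf hu' ⊢
  linear_combination u * hf + X * f * hu' + (2 * X * d⁄dX ℂ f + (C a + C b + n) * f) * hu

theorem hasSum_coeff_one_sub_X_pow_mul {f : PowerSeries ℂ} {x s : ℂ}
    (hf : HasSum (fun k ↦ coeff k f * x ^ k) s) (n : ℕ) :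
    HasSum (fun k ↦ coeff k ((1 - X) ^ n * f) * x ^ k) ((1 - x) ^ n * s) := by
  induction n with
  | zero => simpa using hf
  | succ n ih =>
    have hX : HasSum (fun k ↦ coeff k (X * ((1 - X) ^ n * f)) * x ^ k)
        (x * ((1 - x) ^ n * s)) := by
      rw [← hasSum_nat_add_iff' 1]
      convert! ih.mul_left x using 1
      · ext k
        rw [coeff_succ_X_mul, pow_succ]
        ring
      · simp
    have hmul : (1 - X) ^ (n + 1) * f = (1 - X) ^ n * f - X * ((1 - X) ^ n * f) := by ring
    convert! ih.sub hX using 1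
    · ext k
      rw [hmul, map_sub, sub_mul]
    · ring

theorem summable_norm_regularizedGaussHGFun (a b c : ℂ) {x : ℂ} (hx : ‖x‖ < 1) :
    Summable fun n ↦ ‖regularizedHGFunCoeff {a, b} {c} n * x ^ n‖ := by
  have h := (regularizedGaussHGFunSeries a b c).summable_norm_apply (x := x) <| by
    refine Metric.eball_subset_eball (radius_regularizedGaussHGFunSeries_ge_one a b c) ?_
    simpa [← ofReal_norm] using hx
  simpa [regularizedGaussHGFunSeries, regularizedHGFunSeries, mul_comm] using h

theorem hasSum_regularizedGaussHGFun (a b c : ℂ) {x : ℂ} (hx : ‖x‖ < 1) :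
    HasSum (fun n ↦ regularizedHGFunCoeff {a, b} {c} n * x ^ n)
      (regularizedGaussHGFun a b c x) := by
  convert! (summable_norm_regularizedGaussHGFun a b c hx).of_norm.hasSum using 1
  exact tsum_congr fun n ↦ by simp [regularizedGaussHGFunSeries, regularizedHGFunSeries, mul_comm]

theorem regularizedHGFunCoeff_gauss (a b c : ℂ) (n : ℕ) :
    regularizedHGFunCoeff {a, b} {c} n =
      (ascPochhammer ℂ n).eval a * (ascPochhammer ℂ n).eval b /
        (n.factorial * Gamma (c + n)) := by
  simp [regularizedHGFunCoeff]

theorem regularizedHGFunCoeff_gauss_succ {c : ℂ} (hc : ∀ k : ℕ, c ≠ -k) (a b : ℂ) (n : ℕ) :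
    (n + 1) * (c + n) * regularizedHGFunCoeff {a, b} {c} (n + 1) =
      (a + n) * (b + n) * regularizedHGFunCoeff {a, b} {c} n := by
  have h1 : c + n ≠ 0 := fun h ↦ hc n (eq_neg_of_add_eq_zero_left h)
  have h2 : (n : ℂ) + 1 ≠ 0 := n.cast_add_one_ne_zero
  rw [regularizedHGFunCoeff_add_one (by simpa using hc n)]
  simp
  field_simp

/-- **Euler's transformation** of the hypergeometric function, for `c - a - b` a natural number. -/
theorem regularizedGaussHGFun_eq_one_sub_pow_mul {a b x : ℂ} {n : ℕ}
    (hc : ∀ k : ℕ, a + b + n ≠ -k) (hx : ‖x‖ < 1) :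
    regularizedGaussHGFun a b (a + b + n) x =
      (1 - x) ^ n * regularizedGaussHGFun (a + n) (b + n) (a + b + n) x := by
  set f : PowerSeries ℂ := .mk (regularizedHGFunCoeff {a + n, b + n} {a + b + n})
  have hf := hypergeometric_ode_iff.1 <|
    hypergeometric_ode_one_sub_X_pow_mul (f := f) <| hypergeometric_ode_iff.2 fun k ↦ by
      simpa [f] using regularizedHGFunCoeff_gauss_succ hc (a + n) (b + n) k
  have hcoeff (k : ℕ) :
      coeff k ((1 - X) ^ n * f) = regularizedHGFunCoeff {a, b} {a + b + n} k := by
    induction k with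
    | zero => simp [f, regularizedHGFunCoeff]
    | succ k ih =>
      have h1 : a + b + n + k ≠ 0 := fun h ↦ hc k (eq_neg_of_add_eq_zero_left h)
      have h2 : (k : ℂ) + 1 ≠ 0 := k.cast_add_one_ne_zero
      refine mul_left_cancel₀ (mul_ne_zero h2 h1) ?_
      rw [hf, regularizedHGFunCoeff_gauss_succ hc, ih]
  have hsum : HasSum (fun k ↦ coeff k f * x ^ k)
      (regularizedGaussHGFun (a + n) (b + n) (a + b + n) x) := by
    simpa [f] using hasSum_regularizedGaussHGFun (a + n) (b + n) (a + b + n) hx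
  refine (hasSum_regularizedGaussHGFun a b _ hx).unique ?_
  simpa only [hcoeff] using hasSum_coeff_one_sub_X_pow_mul hsum n

theorem ascPochhammer_eval_nat_add (a : ℂ) (m k : ℕ) :
    (ascPochhammer ℂ (k + m)).eval a =
      (ascPochhammer ℂ m).eval a * (ascPochhammer ℂ k).eval (a + m) := by
  rw [add_comm k, ← ascPochhammer_mul]
  simp

theorem regularizedGaussHGFun_one_sub_nat (a b : ℂ) (m : ℕ) {x : ℂ} (hx : ‖x‖ < 1) :
    regularizedGaussHGFun a b (1 - m) x =
      (ascPochhammer ℂ m).eval a * (ascPochhammer ℂ m).eval b * x ^ m *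
        regularizedGaussHGFun (a + m) (b + m) (1 + m) x := by
  refine (hasSum_regularizedGaussHGFun a b _ hx).unique ?_
  have hlt : ∑ k ∈ Finset.range m, regularizedHGFunCoeff {a, b} {1 - (m : ℂ)} k * x ^ k = 0 := by
    refine Finset.sum_eq_zero fun k hk ↦ ?_
    obtain ⟨j, rfl⟩ := Nat.exists_eq_add_of_lt (Finset.mem_range.1 hk)
    have : (1 - ((k + j + 1 : ℕ) : ℂ)) + k = -(j : ℂ) := by push_cast; ring
    rw [regularizedHGFunCoeff_gauss, this, Gamma_neg_nat_eq_zero]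
    simp
  rw [← hasSum_nat_add_iff' m, hlt, sub_zero]
  convert! (hasSum_regularizedGaussHGFun (a + m) (b + m) (1 + m) hx).mul_left
    ((ascPochhammer ℂ m).eval a * (ascPochhammer ℂ m).eval b * x ^ m) using 2 with k
  have h1 : 1 - (m : ℂ) + (k + m : ℕ) = k + 1 := by push_cast; ring
  have h2 : 1 + (m : ℂ) + k = (k + m : ℕ) + 1 := by push_cast; ring
  rw [regularizedHGFunCoeff_gauss, regularizedHGFunCoeff_gauss, h1, h2, Gamma_nat_eq_factorial,
    Gamma_nat_eq_factorial, ascPochhammer_eval_nat_add, ascPochhammer_eval_nat_add, pow_add]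
  ring

theorem factorial_le_norm_ascPochhammer_eval {c : ℂ} (hc : 1 ≤ c.re) (k : ℕ) :
    (k.factorial : ℝ) ≤ ‖(ascPochhammer ℂ k).eval c‖ := by
  induction k with
  | zero => simp
  | succ k ih =>
    have h : (k : ℝ) + 1 ≤ ‖c + k‖ := by
      refine le_trans ?_ (re_le_norm _)
      simp only [add_re, natCast_re]
      linarith
    rw [ascPochhammer_succ_eval, norm_mul, Nat.factorial_succ, mul_comm]
    push_cast
    gcongr

theorem norm_inv_Gamma_add_nat_le {c : ℂ} (hc : 1 ≤ c.re) (k : ℕ) :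
    ‖(Gamma (c + k))⁻¹‖ ≤ ‖(Gamma c)⁻¹‖ * (k.factorial : ℝ)⁻¹ := by
  have hc' (j : ℕ) : c ≠ -j := fun h ↦ by
    have := congrArg re h
    simp only [neg_re, natCast_re] at this
    linarith [j.cast_nonneg (α := ℝ)]
  have hG := Gamma_ne_zero hc'
  have : Gamma (c + k) = Gamma c * (ascPochhammer ℂ k).eval c := by
    rw [← Gamma_add_nat_div_Gamma_eq c hc']
    field_simp
  rw [this, mul_inv, norm_mul, norm_inv ((ascPochhammer ℂ k).eval c)]
  gcongr
  exact factorial_le_norm_ascPochhammer_eval hc k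

/-- The regularized hypergeometric function is continuous in its lower parameter. -/
theorem continuous_regularizedGaussHGFun_param (a b : ℂ) {x : ℂ} (hx : ‖x‖ < 1) :
    Continuous fun c ↦ regularizedGaussHGFun a b c x := by
  have hΓ : Continuous fun s : ℂ ↦ (Gamma s)⁻¹ := differentiable_one_div_Gamma.continuous
  have hterm (n : ℕ) : Continuous fun c ↦ regularizedHGFunCoeff {a, b} {c} n * x ^ n := by
    simp only [regularizedHGFunCoeff_gauss, div_eq_mul_inv, mul_inv]
    have : Continuous fun c : ℂ ↦ (Gamma (c + n))⁻¹ := hΓ.comp (continuous_add_const _)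
    fun_prop
  refine continuous_iff_continuousAt.2 fun c₀ ↦ ?_
  obtain ⟨N, hN⟩ := exists_nat_gt (2 - c₀.re)
  have hsplit (c : ℂ) : regularizedGaussHGFun a b c x =
      ∑ n ∈ Finset.range N, regularizedHGFunCoeff {a, b} {c} n * x ^ n +
        ∑' k, regularizedHGFunCoeff {a, b} {c} (k + N) * x ^ (k + N) := by
    rw [← (hasSum_regularizedGaussHGFun a b c hx).tsum_eq,
      (hasSum_regularizedGaussHGFun a b c hx).summable.sum_add_tsum_nat_add N]
  simp only [hsplit]
  refine (continuous_finsetSum _ fun n _ ↦ hterm n).continuousAt.add ?_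
  have hsum := ((summable_nat_add_iff N).2
    (summable_norm_regularizedGaussHGFun a b (1 - N) hx)).mul_left (‖(Gamma (c₀ + N))⁻¹‖ + 1)
  refine tendsto_tsum_of_dominated_convergence hsum
    (fun k ↦ (hterm (k + N)).continuousAt) ?_
  have hbdd : ∀ᶠ c in 𝓝 c₀, ‖(Gamma (c + N))⁻¹‖ < ‖(Gamma (c₀ + N))⁻¹‖ + 1 :=
    (hΓ.comp (continuous_add_const (N : ℂ))).norm.continuousAt.eventually_lt_const
      (lt_add_one _)
  have hre : ∀ᶠ c : ℂ in 𝓝 c₀, 1 - N < c.re :=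
    continuous_re.continuousAt.eventually_const_lt (by linarith)
  filter_upwards [hbdd, hre] with c hc hcre k
  have h1 : 1 - (N : ℂ) + (k + N : ℕ) = k + 1 := by push_cast; ring
  have h2 : c + (k + N : ℕ) = c + N + k := by push_cast; ring
  have key := norm_inv_Gamma_add_nat_le (c := c + N) (by simp; linarith) k
  rw [regularizedHGFunCoeff_gauss, regularizedHGFunCoeff_gauss, h1, h2, Gamma_nat_eq_factorial]
  set A := (ascPochhammer ℂ (k + N)).eval a * (ascPochhammer ℂ (k + N)).eval b
  calc
    _ = ‖A / (k + N).factorial * x ^ (k + N)‖ * ‖(Gamma (c + N + k))⁻¹‖ := by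
      rw [← norm_mul]
      congr 1
      ring
    _ ≤ ‖A / (k + N).factorial * x ^ (k + N)‖ *
        ((‖(Gamma (c₀ + N))⁻¹‖ + 1) * (k.factorial : ℝ)⁻¹) := by
      gcongr
      exact key.trans (by gcongr)
    _ = (‖(Gamma (c₀ + N))⁻¹‖ + 1) *
        ‖A / (k + N).factorial * x ^ (k + N) * (k.factorial : ℂ)⁻¹‖ := by
      rw [norm_mul _ (k.factorial : ℂ)⁻¹, norm_inv (k.factorial : ℂ), norm_natCast]
      ring
    _ = _ := by
      congr 2
      ring

end Complex

open Complex in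
theorem Gamma_inv_mul_hyp2F1 {c : ℂ} (hc : ∀ k : ℕ, c ≠ -k) (a b x : ℂ) :
    (Gamma c)⁻¹ * hyp2F1 a b c x = regularizedGaussHGFun a b c x := by
  rw [← ordinaryHypergeometric_div_Gamma_eq hc, ordinaryHypergeometric_eq_tsum, hyp2F1,
    div_eq_inv_mul]
  congr 1
  refine tsum_congr fun n ↦ ?_
  rw [smul_eq_mul]
  ring

theorem PGen_tendsto_PLeg (m : ℕ) (lam : ℂ) (z : ℝ) (hz : z ∈ Set.Ioo (-1 : ℝ) 1) :
    Filter.Tendsto (fun μ : ℂ => PGen μ lam z)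
      (nhdsWithin (m : ℂ) {μ : ℂ | ∀ k : ℕ, 1 - μ ≠ -(k : ℂ)})
      (nhds (PLeg m lam z)) := by
  obtain ⟨hz₁, hz₂⟩ := hz
  set x : ℂ := (((1 - z) / 2 : ℝ) : ℂ) with hx_def
  set w : ℂ := (1 + z) / (1 - z) with hw_def
  have hx : ‖x‖ < 1 := by
    rw [Complex.norm_real, Real.norm_eq_abs, abs_of_pos (by linarith)]
    linarith
  have hp : (1 + z : ℂ) ≠ 0 := by
    exact_mod_cast (by linarith : 1 + z ≠ 0)
  have hn : (1 - z : ℂ) ≠ 0 := by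
    exact_mod_cast (by linarith : 1 - z ≠ 0)
  have hw : w ≠ 0 := div_ne_zero hp hn
  have hw_arg : w.arg ≠ Real.pi := by
    have : w = ((1 + z) / (1 - z) : ℝ) := by push_cast; rfl
    rw [this, Complex.arg_ofReal_of_nonneg (div_nonneg (by linarith) (by linarith))]
    exact Real.pi_pos.ne
  have hc (k : ℕ) : (1 + m : ℂ) ≠ -k := fun h ↦ by
    have : ((1 + m + k : ℕ) : ℂ) = 0 := by push_cast; rw [h]; ring
    exact absurd (Nat.cast_eq_zero.1 this) (by lia)
  have hlim : PLeg m lam z =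
      w ^ ((m : ℂ) / 2) * Complex.regularizedGaussHGFun (-lam) (lam + 1) (1 - m) x := by
    have hsum : -lam + (lam + 1) + m = 1 + m := by ring
    have euler := Complex.regularizedGaussHGFun_eq_one_sub_pow_mul (a := -lam) (b := lam + 1)
      (n := m) (by simpa only [hsum] using hc) hx
    rw [hsum, ← Gamma_inv_mul_hyp2F1 hc, add_comm 1 (m : ℂ), Complex.Gamma_nat_eq_factorial,
      add_comm (m : ℂ) 1] at euler
    have hinv : ((1 - z) / (1 + z) : ℂ) = w⁻¹ := (inv_div _ _).symm
    have hx1 : x = w⁻¹ * (1 - x) := by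
      rw [hx_def, hw_def]
      push_cast
      field_simp
      ring
    have hpow : w ^ ((m : ℂ) / 2) * w ^ ((m : ℂ) / 2) = w ^ m := by
      rw [← Complex.cpow_add _ _ hw, add_halves, Complex.cpow_natCast]
    have hpow_ne : w ^ ((m : ℂ) / 2) ≠ 0 := by simp [Complex.cpow_eq_zero_iff, hw]
    have hxm : w ^ ((m : ℂ) / 2) * x ^ m = (w ^ ((m : ℂ) / 2))⁻¹ * (1 - x) ^ m := by
      rw [hx1, mul_pow, ← hx1, inv_pow, ← hpow]
      field_simp
    rw [Complex.regularizedGaussHGFun_one_sub_nat _ _ _ hx, PLeg, hinv, Complex.inv_cpow _ _ hw_arg,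
      add_comm 1 lam]
    set H := Complex.regularizedGaussHGFun (-lam + m) (lam + 1 + m) (1 + m) x
    set A := (ascPochhammer ℂ m).eval (-lam) * (ascPochhammer ℂ m).eval (lam + 1)
    linear_combination A * (w ^ ((m : ℂ) / 2))⁻¹ * euler - A * H * hxm
  rw [hlim]
  have hcpow : Continuous fun μ : ℂ ↦ w ^ (μ / 2) :=
    (continuous_id.div_const 2).const_cpow (Or.inl hw)
  have hF : Continuous fun μ : ℂ ↦
      Complex.regularizedGaussHGFun (-lam) (lam + 1) (1 - μ) x :=
    (Complex.continuous_regularizedGaussHGFun_param _ _ hx).comp (continuous_sub_left 1)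
  refine ((hcpow.mul hF).tendsto (m : ℂ)).mono_left nhdsWithin_le_nhds |>.congr' ?_
  filter_upwards [self_mem_nhdsWithin] with μ hμ
  rw [PGen, Pi.mul_apply, ← Gamma_inv_mul_hyp2F1 hμ]
  ring
end

section
/- For every λ ∈ ℂ and m ∈ ℕ₀, the function z ↦ P^m_λ(z) is smooth on (−1,1) and is an eigenfunction of L_m with eigenvalue −λ(λ+1): for all z ∈ (−1,1), d/dz((1−z²) (P^m_λ)′(z)) − (m²/(1−z²)) P^m_λ(z) + λ(λ+1) P^m_λ(z) = 0; equivalently (−λ(λ+1) − L_m) P^m_λ = 0. The same holds for the function z ↦ P^m_λ(−z). -/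
open scoped BigOperators

open FormalMultilinearSeries in
theorem HasFPowerSeriesOnBall.deriv_ofScalars {f : ℂ → ℂ} {h : ℕ → ℂ} {r : ENNReal}
    (hf : HasFPowerSeriesOnBall f (ofScalars ℂ h) 0 r) :
    HasFPowerSeriesOnBall (deriv f) (ofScalars ℂ fun n => (n + 1 : ℂ) * h (n + 1)) 0 r := by
  have h1 := (ContinuousLinearMap.apply ℂ ℂ (1 : ℂ)).comp_hasFPowerSeriesOnBall hf.fderiv
  convert! h1 using 1
  refine FormalMultilinearSeries.ext fun n => ?_
  rw [← mkPiRing_coeff_eq (ofScalars ℂ fun n => (n + 1 : ℂ) * h (n + 1)),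
    ← mkPiRing_coeff_eq (ContinuousLinearMap.compFormalMultilinearSeries _ _), coeff_ofScalars]
  congr 1
  refine Eq.trans ?_ (derivSeries_coeff_one (ofScalars ℂ h) n).symm
  simp [coeff_ofScalars, nsmul_eq_mul]

theorem hyp2F1_eq_ordinaryHypergeometric (a b c x : ℂ) :
    hyp2F1 a b c x = ordinaryHypergeometric a b c x := by
  rw [hyp2F1, ordinaryHypergeometric_eq_tsum]
  refine tsum_congr fun n => ?_
  rw [smul_eq_mul, div_eq_mul_inv, mul_inv]
  ring

theorem one_le_radius_ordinaryHypergeometricSeries (a b : ℂ) {c : ℂ} (hc : ∀ k : ℕ, (k : ℂ) ≠ -c) :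
    1 ≤ (ordinaryHypergeometricSeries ℂ a b c).radius := by
  by_cases ha : ∃ k : ℕ, a = -k
  · obtain ⟨k, rfl⟩ := ha
    simp [ordinaryHypergeometric_radius_top_of_neg_nat₁]
  by_cases hb : ∃ k : ℕ, b = -k
  · obtain ⟨k, rfl⟩ := hb
    simp [ordinaryHypergeometric_radius_top_of_neg_nat₂]
  push Not at ha hb
  rw [ordinaryHypergeometricSeries_radius_eq_one ℂ a b c]
  exact fun k => ⟨fun h => ha k (by rw [h, neg_neg]), fun h => hb k (by rw [h, neg_neg]), hc k⟩

theorem hasFPowerSeriesOnBall_hyp2F1 (a b : ℂ) {c : ℂ} (hc : ∀ k : ℕ, (k : ℂ) ≠ -c) :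
    HasFPowerSeriesOnBall (hyp2F1 a b c) (ordinaryHypergeometricSeries ℂ a b c) 0 1 := by
  have hr := one_le_radius_ordinaryHypergeometricSeries a b hc
  have h := ((ordinaryHypergeometricSeries ℂ a b c).hasFPowerSeriesOnBall
    (zero_lt_one.trans_le hr)).mono zero_lt_one hr
  exact h.congr fun x _ => (hyp2F1_eq_ordinaryHypergeometric a b c x).symm

theorem ordinaryHypergeometricCoefficient_succ_mul (a b : ℂ) {c : ℂ}
    (hc : ∀ k : ℕ, (k : ℂ) ≠ -c) (n : ℕ) :
    (n + 1) * (n + c) * ordinaryHypergeometricCoefficient a b c (n + 1) =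
      (n + a) * (n + b) * ordinaryHypergeometricCoefficient a b c n := by
  have h1 : (n + c : ℂ) ≠ 0 := fun h => hc n (eq_neg_of_add_eq_zero_left h)
  have h1' : (c + n : ℂ) ≠ 0 := by rwa [add_comm]
  have h2 : (n + 1 : ℂ) ≠ 0 := by exact_mod_cast n.succ_ne_zero
  have h3 : (n.factorial : ℂ) ≠ 0 := by exact_mod_cast n.factorial_ne_zero
  simp only [ordinaryHypergeometricCoefficient, ascPochhammer_succ_eval, Nat.factorial_succ,
    Nat.cast_mul, Nat.cast_add, Nat.cast_one, mul_inv]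
  field_simp
  ring

theorem HasSum.natCast_mul_pow {g : ℕ → ℂ} {s x : ℂ}
    (hs : HasSum (fun n : ℕ => (n + 1 : ℂ) * g (n + 1) * x ^ n) s) :
    HasSum (fun n : ℕ => n * g n * x ^ n) (x * s) := by
  refine (hasSum_nat_add_iff' 1).mp ?_
  simp only [Finset.sum_range_one, Nat.cast_zero, zero_mul, sub_zero]
  refine (hs.mul_left x).congr_fun fun n => ?_
  push_cast
  ring

/-- Gauss's hypergeometric differential equation. -/
theorem hyp2F1_ode (a b : ℂ) {c : ℂ} (hc : ∀ k : ℕ, (k : ℂ) ≠ -c) {x : ℂ} (hx : ‖x‖ < 1) :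
    x * (1 - x) * deriv (deriv (hyp2F1 a b c)) x
      + (c - (a + b + 1) * x) * deriv (hyp2F1 a b c) x - a * b * hyp2F1 a b c x = 0 := by
  set h := ordinaryHypergeometricCoefficient a b c with hh
  have hF := hasFPowerSeriesOnBall_hyp2F1 a b hc
  rw [ordinaryHypergeometricSeries] at hF
  have hF' := hF.deriv_ofScalars
  have hF'' := hF'.deriv_ofScalars
  have hx' : x ∈ Metric.eball (0 : ℂ) 1 := by
    simpa [← ofReal_norm, ← ENNReal.ofReal_one, ENNReal.ofReal_lt_ofReal_iff] using hx
  have s0 := hF.hasSum hx'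
  have s1 := hF'.hasSum hx'
  have s2 := hF''.hasSum hx'
  simp only [FormalMultilinearSeries.ofScalars_apply_eq, smul_eq_mul, zero_add, ← hh] at s0 s1 s2
  have t1 := s1.natCast_mul_pow (g := h)
  have t2 := HasSum.natCast_mul_pow (g := fun n => (n + 1) * h (n + 1)) s2
  have t3 := HasSum.natCast_mul_pow (g := fun n => (n - 1) * h n)
    (t2.congr_fun fun n => by push_cast; ring)
  have key := (((t2.sub t3).add (s1.mul_left c)).sub (t1.mul_left (a + b + 1))).sub
    (s0.mul_left (a * b))
  have hz := key.unique (hasSum_zero.congr_fun fun n => ?_)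
  · linear_combination hz
  · have := ordinaryHypergeometricCoefficient_succ_mul a b hc n
    rw [← hh] at this
    linear_combination x ^ n * this

theorem analyticAt_hyp2F1 (a b : ℂ) {c : ℂ} (hc : ∀ k : ℕ, (k : ℂ) ≠ -c) {x : ℂ} (hx : ‖x‖ < 1) :
    AnalyticAt ℂ (hyp2F1 a b c) x := by
  refine (hasFPowerSeriesOnBall_hyp2F1 a b hc).analyticAt_of_mem ?_
  simpa [← ofReal_norm, ← ENNReal.ofReal_one, ENNReal.ofReal_lt_ofReal_iff] using hx

theorem natCast_ne_neg_one_add_natCast (m k : ℕ) : (k : ℂ) ≠ -(1 + (m : ℂ)) := by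
  intro h
  have h' : ((k + (1 + m) : ℕ) : ℂ) = 0 := by
    push_cast
    rw [h, neg_add_cancel]
  have := Nat.cast_eq_zero.mp h'
  omega


theorem norm_one_sub_div_two_lt_one {z : ℝ} (hz : z ∈ Set.Ioo (-1 : ℝ) 1) :
    ‖(1 - (z : ℂ)) / 2‖ < 1 := by
  have h : (1 - (z : ℂ)) / 2 = (((1 - z) / 2 : ℝ) : ℂ) := by push_cast; rfl
  rw [h, Complex.norm_real, Real.norm_eq_abs, abs_lt]
  constructor <;> linarith [hz.1, hz.2]

theorem one_sub_div_one_add_mem_slitPlane {z : ℝ} (hz : z ∈ Set.Ioo (-1 : ℝ) 1) :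
    (1 - (z : ℂ)) / (1 + z) ∈ Complex.slitPlane := by
  have h : (1 - (z : ℂ)) / (1 + z) = (((1 - z) / (1 + z) : ℝ) : ℂ) := by push_cast; rfl
  rw [h, Complex.ofReal_mem_slitPlane]
  exact div_pos (by linarith [hz.2]) (by linarith [hz.1])

theorem one_sub_ofReal_ne_zero {z : ℝ} (hz : z ∈ Set.Ioo (-1 : ℝ) 1) : (1 - (z : ℂ)) ≠ 0 := by
  exact_mod_cast (sub_pos.mpr hz.2).ne'

theorem one_add_ofReal_ne_zero {z : ℝ} (hz : z ∈ Set.Ioo (-1 : ℝ) 1) : (1 + (z : ℂ)) ≠ 0 := by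
  exact_mod_cast (by linarith [hz.1] : 0 < 1 + z).ne'

theorem PLeg_eq (m : ℕ) (lam : ℂ) (z : ℝ) :
    PLeg m lam z =
      ((ascPochhammer ℂ m).eval (-lam) * (ascPochhammer ℂ m).eval (1 + lam) / (m.factorial : ℂ)) *
        ((1 - (z : ℂ)) / (1 + z)) ^ ((m : ℂ) / 2) *
        hyp2F1 (-lam) (lam + 1) (1 + (m : ℂ)) ((1 - (z : ℂ)) / 2) := by
  rw [PLeg]
  push_cast
  rfl

theorem contDiffOn_PLeg (m : ℕ) (lam : ℂ) :
    ContDiffOn ℝ (⊤ : ℕ∞) (fun z : ℝ => PLeg m lam z) (Set.Ioo (-1 : ℝ) 1) := by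
  intro z hz
  refine ContDiffAt.contDiffWithinAt (AnalyticAt.contDiffAt ?_)
  simp only [PLeg_eq]
  have hofReal : AnalyticAt ℝ (fun x : ℝ => (x : ℂ)) z := Complex.ofRealCLM.analyticAt z
  have hF : AnalyticAt ℂ (fun w : ℂ => hyp2F1 (-lam) (lam + 1) (1 + (m : ℂ)) ((1 - w) / 2)) z :=
    (analyticAt_hyp2F1 _ _ (natCast_ne_neg_one_add_natCast m)
      (norm_one_sub_div_two_lt_one hz)).comp_of_eq (f := fun w : ℂ => (1 - w) / 2)
        (by fun_prop) rfl
  have hW : AnalyticAt ℂ (fun w : ℂ => ((1 - w) / (1 + w)) ^ ((m : ℂ) / 2)) z :=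
    AnalyticAt.cpow ((analyticAt_const.sub analyticAt_id).div (analyticAt_const.add analyticAt_id)
      (one_add_ofReal_ne_zero hz)) analyticAt_const (one_sub_div_one_add_mem_slitPlane hz)
  exact (((analyticAt_const.mul hW).mul hF).restrictScalars (𝕜 := ℝ)).comp hofReal

theorem hasDerivAt_one_sub_div_one_add_cpow (s : ℂ) {z : ℝ} (hz : z ∈ Set.Ioo (-1 : ℝ) 1) :
    HasDerivAt (fun x : ℝ => ((1 - (x : ℂ)) / (1 + x)) ^ (s / 2))
      (-(s / (1 - (z : ℂ) ^ 2)) * ((1 - (z : ℂ)) / (1 + z)) ^ (s / 2)) z := by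
  have h1 := one_sub_ofReal_ne_zero hz
  have h2 := one_add_ofReal_ne_zero hz
  have hq : HasDerivAt (fun w : ℂ => (1 - w) / (1 + w))
      ((-1 * (1 + (z : ℂ)) - (1 - z) * 1) / (1 + (z : ℂ)) ^ 2) z :=
    ((hasDerivAt_id (z : ℂ)).const_sub 1).div ((hasDerivAt_id (z : ℂ)).const_add 1) h2
  convert (hq.cpow_const (c := s / 2) (one_sub_div_one_add_mem_slitPlane hz)).comp_ofReal using 1
  rw [Complex.cpow_sub _ _ (div_ne_zero h1 h2), Complex.cpow_one,
    show 1 - (z : ℂ) ^ 2 = (1 - z) * (1 + z) by ring]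
  field_simp
  ring

theorem AnalyticAt.hasDerivAt_comp_one_sub_div_two {F : ℂ → ℂ} {z : ℝ}
    (hF : AnalyticAt ℂ F ((1 - (z : ℂ)) / 2)) :
    HasDerivAt (fun x : ℝ => F ((1 - (x : ℂ)) / 2)) (-deriv F ((1 - (z : ℂ)) / 2) / 2) z := by
  have h : HasDerivAt (fun w : ℂ => (1 - w) / 2) (-1 / 2) (z : ℂ) :=
    ((hasDerivAt_id (z : ℂ)).const_sub 1).div_const 2
  have hc := (HasDerivAt.comp (z : ℂ) (h₂ := F) hF.differentiableAt.hasDerivAt h).comp_ofReal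
  rwa [mul_div_assoc', mul_neg_one] at hc

theorem one_sub_sq_mul_deriv_PLeg (m : ℕ) (lam : ℂ) {z : ℝ} (hz : z ∈ Set.Ioo (-1 : ℝ) 1) :
    ((1 - z ^ 2 : ℝ) : ℂ) * deriv (fun t : ℝ => PLeg m lam t) z =
      ((ascPochhammer ℂ m).eval (-lam) * (ascPochhammer ℂ m).eval (1 + lam) / (m.factorial : ℂ)) *
        ((1 - (z : ℂ)) / (1 + z)) ^ ((m : ℂ) / 2) *
        ((1 - (z : ℂ) ^ 2) *
            (-deriv (hyp2F1 (-lam) (lam + 1) (1 + (m : ℂ))) ((1 - (z : ℂ)) / 2) / 2) -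
          m * hyp2F1 (-lam) (lam + 1) (1 + (m : ℂ)) ((1 - (z : ℂ)) / 2)) := by
  have hF := analyticAt_hyp2F1 (-lam) (lam + 1) (natCast_ne_neg_one_add_natCast m)
    (norm_one_sub_div_two_lt_one hz)
  have hne : 1 - (z : ℂ) ^ 2 ≠ 0 := by
    rw [show 1 - (z : ℂ) ^ 2 = (1 - z) * (1 + z) by ring]
    exact mul_ne_zero (one_sub_ofReal_ne_zero hz) (one_add_ofReal_ne_zero hz)
  simp only [PLeg_eq]
  rw [(((hasDerivAt_one_sub_div_one_add_cpow m hz).const_mul _).fun_mul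
    hF.hasDerivAt_comp_one_sub_div_two).deriv]
  push_cast
  field_simp
  ring

theorem PLeg_ode (m : ℕ) (lam : ℂ) {z : ℝ} (hz : z ∈ Set.Ioo (-1 : ℝ) 1) :
    deriv (fun x : ℝ => ((1 - x ^ 2 : ℝ) : ℂ) * deriv (fun t : ℝ => PLeg m lam t) x) z
      - ((m : ℂ) ^ 2 / (1 - (z : ℂ) ^ 2)) * PLeg m lam z
      + lam * (lam + 1) * PLeg m lam z = 0 := by
  have hu := norm_one_sub_div_two_lt_one hz
  have hF := analyticAt_hyp2F1 (-lam) (lam + 1) (natCast_ne_neg_one_add_natCast m) hu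
  have hode := hyp2F1_ode (-lam) (lam + 1) (natCast_ne_neg_one_add_natCast m) hu
  have hne : 1 - (z : ℂ) ^ 2 ≠ 0 := by
    rw [show 1 - (z : ℂ) ^ 2 = (1 - z) * (1 + z) by ring]
    exact mul_ne_zero (one_sub_ofReal_ne_zero hz) (one_add_ofReal_ne_zero hz)
  have heq := Filter.eventuallyEq_of_mem (isOpen_Ioo.mem_nhds hz)
    fun x hx => one_sub_sq_mul_deriv_PLeg m lam hx
  have hsq : HasDerivAt (fun x : ℝ => 1 - (x : ℂ) ^ 2) (-(2 * (z : ℂ))) z := by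
    have := ((hasDerivAt_pow 2 (z : ℂ)).const_sub 1).comp_ofReal
    simpa using this
  rw [heq.deriv_eq, (((hasDerivAt_one_sub_div_one_add_cpow m hz).const_mul _).fun_mul
    ((hsq.fun_mul (hF.deriv.hasDerivAt_comp_one_sub_div_two.fun_neg.div_const 2)).fun_sub
      (hF.hasDerivAt_comp_one_sub_div_two.const_mul _))).deriv, PLeg_eq]
  generalize (1 - (z : ℂ)) / (1 + z) = q at *
  generalize q ^ ((m : ℂ) / 2) = W at *
  generalize Polynomial.eval (-lam) _ * Polynomial.eval (1 + lam) _ / (m.factorial : ℂ) = K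
  field_simp
  linear_combination 4 * (1 - (z : ℂ) ^ 2) * K * W * hode

theorem deriv_one_sub_sq_mul_deriv_comp_neg (f : ℝ → ℂ) (z : ℝ) :
    deriv (fun x : ℝ => ((1 - x ^ 2 : ℝ) : ℂ) * deriv (fun t : ℝ => f (-t)) x) z =
      deriv (fun x : ℝ => ((1 - x ^ 2 : ℝ) : ℂ) * deriv f x) (-z) := by
  have h : (fun x : ℝ => ((1 - x ^ 2 : ℝ) : ℂ) * deriv (fun t : ℝ => f (-t)) x) =
      fun x => -(fun y : ℝ => ((1 - y ^ 2 : ℝ) : ℂ) * deriv f y) (-x) := by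
    ext x
    simp only [deriv_comp_neg, neg_sq, mul_neg]
  rw [h, deriv.fun_neg, deriv_comp_neg fun y : ℝ => ((1 - y ^ 2 : ℝ) : ℂ) * deriv f y,
    neg_neg]

theorem PLeg_eigenfunction (m : ℕ) (lam : ℂ) :
    ContDiffOn ℝ (⊤ : ℕ∞) (fun z : ℝ => PLeg m lam z) (Set.Ioo (-1 : ℝ) 1) ∧
    (∀ z ∈ Set.Ioo (-1 : ℝ) 1,
      deriv (fun x : ℝ => ((1 - x ^ 2 : ℝ) : ℂ) * deriv (fun t : ℝ => PLeg m lam t) x) z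
        - ((m : ℂ) ^ 2 / (1 - (z : ℂ) ^ 2)) * PLeg m lam z
        + lam * (lam + 1) * PLeg m lam z = 0) ∧
    ContDiffOn ℝ (⊤ : ℕ∞) (fun z : ℝ => PLeg m lam (-z)) (Set.Ioo (-1 : ℝ) 1) ∧
    ∀ z ∈ Set.Ioo (-1 : ℝ) 1,
      deriv (fun x : ℝ => ((1 - x ^ 2 : ℝ) : ℂ) * deriv (fun t : ℝ => PLeg m lam (-t)) x) z
        - ((m : ℂ) ^ 2 / (1 - (z : ℂ) ^ 2)) * PLeg m lam (-z)
        + lam * (lam + 1) * PLeg m lam (-z) = 0 := by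
  have hneg : ∀ z ∈ Set.Ioo (-1 : ℝ) 1, -z ∈ Set.Ioo (-1 : ℝ) 1 :=
    fun z hz => ⟨neg_lt_neg hz.2, neg_lt.mp hz.1⟩
  refine ⟨contDiffOn_PLeg m lam, fun z hz => PLeg_ode m lam hz,
    (contDiffOn_PLeg m lam).comp contDiff_neg.contDiffOn hneg, fun z hz => ?_⟩
  rw [deriv_one_sub_sq_mul_deriv_comp_neg (PLeg m lam)]
  simpa using PLeg_ode m lam (hneg z hz)
end

section
/- For every λ ∈ ℂ∖ℤ, m ∈ ℕ₀ and z ∈ (−1,1), the Wronskian of P^m_λ(z) and P^m_λ(−z) satisfies P^m_λ(z) · (d/dz)[P^m_λ(−z)] − (d/dz)[P^m_λ(z)] · P^m_λ(−z) = 2 (1−z²)^{−1} / (Γ(λ+1−m) Γ(−λ−m)). In particular, since the right-hand side is nonzero, the functions z ↦ P^m_λ(z) and z ↦ P^m_λ(−z) are linearly independent on (−1,1). -/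
open scoped BigOperators

open Filter Topology

/-- A power series with bounded coefficients may be differentiated term by term in the
open unit disc. -/
theorem hasDerivAt_tsum_pow_of_bounded {c : ℕ → ℂ} {K : ℝ} (hc : ∀ n, ‖c n‖ ≤ K) {x : ℂ}
    (hx : ‖x‖ < 1) :
    ∃ D, HasDerivAt (fun y => ∑' n, c n * y ^ n) D x ∧
      HasSum (fun n : ℕ => c n * (n * x ^ (n - 1))) D := by
  obtain ⟨r, hxr, hr1⟩ := exists_between hx
  have hr0 : 0 ≤ r := (norm_nonneg x).trans hxr.le
  have hr : ‖r‖ < 1 := by rwa [Real.norm_of_nonneg hr0]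
  have hK : 0 ≤ K := (norm_nonneg _).trans (hc 0)
  have hu : Summable fun n : ℕ => K * (n * r ^ (n - 1)) := by
    refine Summable.mul_left K ((summable_nat_add_iff 1).1 ?_)
    have h1 := summable_pow_mul_geometric_of_norm_lt_one 1 hr
    have h0 := summable_geometric_of_norm_lt_one hr
    refine (h1.add h0).congr fun n => ?_
    simp [add_mul]
  have hbound : ∀ (n : ℕ) (y : ℂ), y ∈ Metric.ball (0 : ℂ) r →
      ‖c n * (n * y ^ (n - 1))‖ ≤ K * (n * r ^ (n - 1)) := by
    intro n y hy
    have hy' : ‖y‖ ≤ r := (mem_ball_zero_iff.1 hy).le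
    simp only [norm_mul, norm_pow, Complex.norm_natCast]
    gcongr
    exact hc n
  have hx' : x ∈ Metric.ball (0 : ℂ) r := mem_ball_zero_iff.2 hxr
  have h0 : Summable fun n : ℕ => c n * (0 : ℂ) ^ n :=
    summable_of_ne_finset_zero (s := {0}) fun n hn => by
      rw [zero_pow (by simpa using hn), mul_zero]
  exact ⟨_, hasDerivAt_tsum_of_isPreconnected hu Metric.isOpen_ball
    (convex_ball _ _).isPreconnected (fun n y _ => (hasDerivAt_pow n y).const_mul (c n))
    hbound (Metric.mem_ball_self ((norm_nonneg x).trans_lt hxr)) h0 hx',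
    (Summable.of_norm_bounded hu fun n => hbound n x hx').hasSum⟩

theorem hasSum_tsum_pow_of_bounded {c : ℕ → ℂ} {K : ℝ} (hc : ∀ n, ‖c n‖ ≤ K) {x : ℂ}
    (hx : ‖x‖ < 1) : HasSum (fun n => c n * x ^ n) (∑' n, c n * x ^ n) := by
  refine (Summable.of_norm_bounded
    ((summable_geometric_of_lt_one (norm_nonneg x) hx).mul_left K) fun n => ?_).hasSum
  rw [norm_mul, norm_pow]
  gcongr
  exact hc n

theorem ascPochhammer_eval_ne_zero_of_forall {c : ℂ} (hc : ∀ k : ℕ, c + k ≠ 0) (n : ℕ) :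
    (ascPochhammer ℂ n).eval c ≠ 0 := by
  induction n with
  | zero => simp
  | succ n ih =>
    rw [ascPochhammer_succ_eval]
    exact mul_ne_zero ih (hc n)

theorem ascPochhammer_eval_eq_prod_range (s : ℂ) (n : ℕ) :
    (ascPochhammer ℂ n).eval s = ∏ j ∈ Finset.range n, (s + j) := by
  induction n with
  | zero => simp
  | succ n ih => rw [ascPochhammer_succ_eval, Finset.prod_range_succ, ih]

theorem mul_ascPochhammer_eval_add_one (c : ℂ) (n : ℕ) :
    c * (ascPochhammer ℂ n).eval (c + 1) = (ascPochhammer ℂ n).eval c * (c + n) := by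
  rw [← ascPochhammer_succ_eval, ascPochhammer_succ_left]
  simp

/-- The power series coefficients of `₂F₁(-λ, λ+1; 1+m; ·)`. -/
noncomputable def legendreCoeff (lam : ℂ) (m n : ℕ) : ℂ :=
  (ascPochhammer ℂ n).eval (-lam) * (ascPochhammer ℂ n).eval (lam + 1) /
    ((ascPochhammer ℂ n).eval (1 + (m : ℂ)) * (n.factorial : ℂ))

theorem natCast_add_one_add_natCast_ne_zero (m n : ℕ) : (1 + (m : ℂ)) + n ≠ 0 := by
  exact_mod_cast (by omega : (1 + m) + n ≠ 0)

@[simp]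
theorem legendreCoeff_zero (lam : ℂ) (m : ℕ) : legendreCoeff lam m 0 = 1 := by
  simp [legendreCoeff]

theorem legendreCoeff_succ (lam : ℂ) (m n : ℕ) :
    (1 + m + n) * (n + 1) * legendreCoeff lam m (n + 1) =
      (n - lam) * (n + lam + 1) * legendreCoeff lam m n := by
  have h1 := ascPochhammer_eval_ne_zero_of_forall (natCast_add_one_add_natCast_ne_zero m) n
  have h2 := natCast_add_one_add_natCast_ne_zero m n
  have h3 : (n.factorial : ℂ) ≠ 0 := by exact_mod_cast n.factorial_ne_zero
  have h4 : (n : ℂ) + 1 ≠ 0 := by exact_mod_cast n.succ_ne_zero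
  simp only [legendreCoeff, ascPochhammer_succ_eval, Nat.factorial_succ, Nat.cast_mul,
    Nat.cast_add, Nat.cast_one]
  field_simp
  ring

theorem legendreCoeff_order_succ (lam : ℂ) (m n : ℕ) :
    (1 + m + n) * legendreCoeff lam (m + 1) n = (1 + m) * legendreCoeff lam m n := by
  have h1 := ascPochhammer_eval_ne_zero_of_forall (natCast_add_one_add_natCast_ne_zero m) n
  have h1' := ascPochhammer_eval_ne_zero_of_forall
    (natCast_add_one_add_natCast_ne_zero (m + 1)) n
  have h3 : (n.factorial : ℂ) ≠ 0 := by exact_mod_cast n.factorial_ne_zero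
  have h := mul_ascPochhammer_eval_add_one (1 + m) n
  have h5 : (1 : ℂ) + m + 1 = 1 + ((m + 1 : ℕ) : ℂ) := by push_cast; ring
  rw [h5] at h
  simp only [legendreCoeff]
  field_simp
  linear_combination (-(Polynomial.eval (-lam) (ascPochhammer ℂ n)) *
    (Polynomial.eval (lam + 1) (ascPochhammer ℂ n))) * h

/-- The coefficientwise form of `(1 - x) u' + m u = v`, where `u` and `v` are the Legendre
series of orders `m` and (up to a factor) `m + 1`. -/
theorem legendreCoeff_telescope (lam : ℂ) (m n : ℕ) :
    (n + 1) * legendreCoeff lam m (n + 1) - n * legendreCoeff lam m n +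
        m * legendreCoeff lam m n =
      (m - lam) * (m + 1 + lam) / (m + 1) * legendreCoeff lam (m + 1) n := by
  have h2 := natCast_add_one_add_natCast_ne_zero m n
  have h4 : (m : ℂ) + 1 ≠ 0 := by exact_mod_cast m.succ_ne_zero
  have e1 := legendreCoeff_succ lam m n
  have e2 := legendreCoeff_order_succ lam m n
  have e3 : (1 + m + n) * ((m - lam) * (m + 1 + lam) / (m + 1) * legendreCoeff lam (m + 1) n) =
      (m - lam) * (m + 1 + lam) * legendreCoeff lam m n := by
    rw [mul_left_comm, e2]
    field_simp
    ring
  apply mul_left_cancel₀ h2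
  linear_combination e1 - e3

theorem tendsto_natCast_mul_legendreCoeff {lam : ℂ} (hlam : ∀ n : ℤ, lam ≠ (n : ℂ)) :
    Tendsto (fun n : ℕ => (n : ℂ) * legendreCoeff lam 0 n) atTop
      (𝓝 (Complex.Gamma (lam + 1) * Complex.Gamma (-lam))⁻¹) := by
  have g1 : Complex.Gamma (lam + 1) ≠ 0 := Complex.Gamma_ne_zero fun k hk =>
    hlam (-k - 1) (by push_cast; linear_combination hk)
  have g2 : Complex.Gamma (-lam) ≠ 0 := Complex.Gamma_ne_zero fun k hk =>
    hlam k (by push_cast; linear_combination -hk)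
  have hG := ((Complex.GammaSeq_tendsto_Gamma (lam + 1)).mul
    (Complex.GammaSeq_tendsto_Gamma (-lam))).inv₀ (mul_ne_zero g1 g2)
  have hq := (tendsto_natCast_div_add_atTop (𝕜 := ℂ) 1).mul hG
  rw [one_mul] at hq
  rw [← tendsto_add_atTop_iff_nat 1]
  refine hq.congr' ?_
  filter_upwards [eventually_ne_atTop 0] with n hn
  have hn' : (n : ℂ) ≠ 0 := by exact_mod_cast hn
  have h3 : (n.factorial : ℂ) ≠ 0 := by exact_mod_cast n.factorial_ne_zero
  have h4 : (n : ℂ) + 1 ≠ 0 := by exact_mod_cast n.succ_ne_zero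
  have hpow : (n : ℂ) ^ (lam + 1) * (n : ℂ) ^ (-lam) = n := by
    rw [← Complex.cpow_add _ _ hn']
    simp
  simp only [Complex.GammaSeq, ← ascPochhammer_eval_eq_prod_range, legendreCoeff, Nat.cast_zero,
    add_zero, ascPochhammer_eval_one, Nat.factorial_succ, Nat.cast_mul, Nat.cast_add,
    Nat.cast_one]
  generalize Polynomial.eval (-lam) (ascPochhammer ℂ (n + 1)) = A
  generalize Polynomial.eval (lam + 1) (ascPochhammer ℂ (n + 1)) = B
  rw [div_mul_div_comm, inv_div]
  rw [show (n : ℂ) ^ (lam + 1) * n.factorial * ((n : ℂ) ^ (-lam) * n.factorial)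
    = n * n.factorial ^ 2 by linear_combination (n.factorial : ℂ) ^ 2 * hpow]
  field_simp

theorem exists_norm_legendreCoeff_le {lam : ℂ} (hlam : ∀ n : ℤ, lam ≠ (n : ℂ)) :
    ∃ K : ℝ, ∀ m n : ℕ, (n + 1) * ‖legendreCoeff lam m n‖ ≤ K := by
  obtain ⟨K, hK⟩ := (Metric.isBounded_range_of_tendsto _
    (tendsto_natCast_mul_legendreCoeff hlam)).exists_norm_le
  refine ⟨2 * K + 1, fun m n => ?_⟩
  induction m with
  | zero =>
    have h := hK _ ⟨n, rfl⟩
    simp only [norm_mul, Complex.norm_natCast] at h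
    rcases Nat.eq_zero_or_pos n with rfl | hn
    · simp only [CharP.cast_eq_zero, zero_mul] at h
      simpa using h
    · have : (1 : ℝ) ≤ n := by exact_mod_cast hn
      nlinarith [norm_nonneg (legendreCoeff lam 0 n)]
  | succ m ih =>
    refine le_trans ?_ ih
    gcongr
    have h := congrArg norm (legendreCoeff_order_succ lam m n)
    have e1 : ‖(1 : ℂ) + m + n‖ = 1 + m + n := by
      rw [← Complex.norm_of_nonneg (by positivity : (0 : ℝ) ≤ 1 + m + n)]; push_cast; rfl
    have e2 : ‖(1 : ℂ) + m‖ = 1 + m := by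
      rw [← Complex.norm_of_nonneg (by positivity : (0 : ℝ) ≤ 1 + m)]; push_cast; rfl
    rw [norm_mul, norm_mul, e1, e2] at h
    have hm : (0 : ℝ) < 1 + m := by positivity
    refine le_of_mul_le_mul_left ?_ hm
    rw [← h]
    exact mul_le_mul_of_nonneg_right (le_add_of_nonneg_right n.cast_nonneg) (norm_nonneg _)

theorem exists_norm_legendreCoeff_succ_le {lam : ℂ} (hlam : ∀ n : ℤ, lam ≠ (n : ℂ)) (m : ℕ) :
    ∃ K : ℝ, ∀ n : ℕ, ‖legendreCoeff lam (m + 1) n‖ ≤ K * (1 / ((n : ℝ) + 1) ^ 2) := by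
  obtain ⟨K, hK⟩ := exists_norm_legendreCoeff_le hlam
  refine ⟨(1 + m) * K, fun n => ?_⟩
  have h := congrArg norm (legendreCoeff_order_succ lam m n)
  have e1 : ‖(1 : ℂ) + m + n‖ = 1 + m + n := by
    rw [← Complex.norm_of_nonneg (by positivity : (0 : ℝ) ≤ 1 + m + n)]; push_cast; rfl
  have e2 : ‖(1 : ℂ) + m‖ = 1 + m := by
    rw [← Complex.norm_of_nonneg (by positivity : (0 : ℝ) ≤ 1 + m)]; push_cast; rfl
  rw [norm_mul, norm_mul, e1, e2] at h
  rw [mul_one_div, le_div_iff₀ (by positivity)]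
  have h1 : ((n : ℝ) + 1) * ‖legendreCoeff lam (m + 1) n‖ ≤
      (1 + m) * ‖legendreCoeff lam m n‖ := by
    rw [← h]
    refine mul_le_mul_of_nonneg_right ?_ (norm_nonneg _)
    have := m.cast_nonneg (α := ℝ)
    linarith
  calc ‖legendreCoeff lam (m + 1) n‖ * ((n : ℝ) + 1) ^ 2
      = (n + 1) * (((n : ℝ) + 1) * ‖legendreCoeff lam (m + 1) n‖) := by ring
    _ ≤ (n + 1) * ((1 + m) * ‖legendreCoeff lam m n‖) := by gcongr
    _ = (1 + m) * ((n + 1) * ‖legendreCoeff lam m n‖) := by ring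
    _ ≤ (1 + m) * K := by gcongr; exact hK m n

theorem summable_one_div_natCast_add_one_sq :
    Summable fun n : ℕ => 1 / ((n : ℝ) + 1) ^ 2 := by
  simpa using (summable_nat_add_iff 1).2 (Real.summable_one_div_nat_pow.2 one_lt_two)

theorem summable_legendreCoeff_succ {lam : ℂ} (hlam : ∀ n : ℤ, lam ≠ (n : ℂ)) (m : ℕ) :
    Summable fun n => ‖legendreCoeff lam (m + 1) n‖ := by
  obtain ⟨K, hK⟩ := exists_norm_legendreCoeff_succ_le hlam m
  exact Summable.of_nonneg_of_le (fun _ => norm_nonneg _) hK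
    (summable_one_div_natCast_add_one_sq.mul_left K)

theorem tendsto_natCast_mul_legendreCoeff_succ {lam : ℂ} (hlam : ∀ n : ℤ, lam ≠ (n : ℂ))
    (m : ℕ) :
    Tendsto (fun n : ℕ => (n : ℂ) * legendreCoeff lam (m + 1) n) atTop (𝓝 0) := by
  obtain ⟨K, hK⟩ := exists_norm_legendreCoeff_succ_le hlam m
  have hlim : Tendsto (fun n : ℕ => K * (1 / ((n : ℝ) + 1))) atTop (𝓝 0) := by
    simpa using tendsto_one_div_add_atTop_nhds_zero_nat.const_mul K
  refine squeeze_zero_norm (fun n => ?_) hlim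
  rw [norm_mul, Complex.norm_natCast]
  calc (n : ℝ) * ‖legendreCoeff lam (m + 1) n‖
      ≤ (n + 1) * (K * (1 / ((n : ℝ) + 1) ^ 2)) := by gcongr; linarith; exact hK n
    _ = K * (1 / ((n : ℝ) + 1)) := by field_simp

/-- The boundary value at `1` of the function `legendreV lam m`. -/
noncomputable def legendreBoundary (lam : ℂ) (m : ℕ) : ℂ :=
  (m - lam) * (m + 1 + lam) / (m + 1) * ∑' n, legendreCoeff lam (m + 1) n

/-- Summing the telescoping coefficient identity. -/
theorem tendsto_sum_legendre_telescope (lam : ℂ) (hlam : ∀ n : ℤ, lam ≠ (n : ℂ)) (m : ℕ) :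
    Tendsto (fun N : ℕ => (N : ℂ) * legendreCoeff lam m N +
      m * ∑ n ∈ Finset.range N, legendreCoeff lam m n) atTop (𝓝 (legendreBoundary lam m)) := by
  have h := ((summable_legendreCoeff_succ hlam m).of_norm.hasSum.mul_left
    ((m - lam) * (m + 1 + lam) / (m + 1))).tendsto_sum_nat
  refine h.congr fun N => ?_
  induction N with
  | zero => simp
  | succ N ih =>
    rw [Finset.sum_range_succ, ih, Finset.sum_range_succ, ← legendreCoeff_telescope]
    push_cast
    ring

theorem legendreBoundary_zero {lam : ℂ} (hlam : ∀ n : ℤ, lam ≠ (n : ℂ)) :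
    legendreBoundary lam 0 = (Complex.Gamma (lam + 1) * Complex.Gamma (-lam))⁻¹ := by
  refine tendsto_nhds_unique (tendsto_sum_legendre_telescope lam hlam 0) ?_
  simpa using tendsto_natCast_mul_legendreCoeff hlam

theorem legendreBoundary_succ {lam : ℂ} (hlam : ∀ n : ℤ, lam ≠ (n : ℂ)) (m : ℕ) :
    (m - lam) * (m + 1 + lam) * legendreBoundary lam (m + 1) =
      (m + 1) ^ 2 * legendreBoundary lam m := by
  have h : legendreBoundary lam (m + 1) =
      (m + 1 : ℕ) * ∑' n, legendreCoeff lam (m + 1) n := by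
    refine tendsto_nhds_unique (tendsto_sum_legendre_telescope lam hlam (m + 1)) ?_
    simpa only [zero_add] using (tendsto_natCast_mul_legendreCoeff_succ hlam m).add
      ((summable_legendreCoeff_succ hlam m).of_norm.hasSum.tendsto_sum_nat.const_mul
        ((m + 1 : ℕ) : ℂ))
  have h4 : (m : ℂ) + 1 ≠ 0 := by exact_mod_cast m.succ_ne_zero
  rw [h, legendreBoundary]
  push_cast
  field_simp

theorem ascPochhammer_sq_mul_legendreBoundary {lam : ℂ} (hlam : ∀ n : ℤ, lam ≠ (n : ℂ))
    (m : ℕ) :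
    ((ascPochhammer ℂ m).eval (-lam) * (ascPochhammer ℂ m).eval (1 + lam) /
        (m.factorial : ℂ)) ^ 2 * legendreBoundary lam m =
      (Complex.Gamma (lam + 1 - m) * Complex.Gamma (-lam - m))⁻¹ := by
  induction m with
  | zero => simp [legendreBoundary_zero hlam]
  | succ m ih =>
    have h1 : (lam - m : ℂ) ≠ 0 := fun h => hlam m (by push_cast; linear_combination h)
    have h2 : (-lam - m - 1 : ℂ) ≠ 0 := fun h =>
      hlam (-m - 1) (by push_cast; linear_combination -h)
    have g1 := Complex.Gamma_add_one _ h1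
    have g2 := Complex.Gamma_add_one _ h2
    rw [show lam - m + 1 = lam + 1 - m by ring] at g1
    rw [show -lam - m - 1 + 1 = -lam - m by ring] at g2
    rw [g1, g2] at ih
    have h3 : (m.factorial : ℂ) ≠ 0 := by exact_mod_cast m.factorial_ne_zero
    have h4 : (m : ℂ) + 1 ≠ 0 := by exact_mod_cast m.succ_ne_zero
    have hb := legendreBoundary_succ hlam m
    rw [ascPochhammer_succ_eval, ascPochhammer_succ_eval, Nat.factorial_succ]
    push_cast
    rw [show lam + 1 - (m + 1 : ℂ) = lam - m by ring,
      show -lam - (m + 1 : ℂ) = -lam - m - 1 by ring]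
    generalize Polynomial.eval (-lam) (ascPochhammer ℂ m) = A at *
    generalize Polynomial.eval (1 + lam) (ascPochhammer ℂ m) = B at *
    calc (A * (-lam + m) * (B * (1 + lam + m)) / ((m + 1) * m.factorial)) ^ 2 *
          legendreBoundary lam (m + 1)
        = (A * B / m.factorial) ^ 2 * ((m - lam) * (m + 1 + lam)) / (m + 1) ^ 2 *
          ((m - lam) * (m + 1 + lam) * legendreBoundary lam (m + 1)) := by
          field_simp
          ring
      _ = ((lam - m) * (-lam - m - 1)) *
          ((A * B / m.factorial) ^ 2 * legendreBoundary lam m) := by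
          rw [hb]
          field_simp
          ring
      _ = _ := by
          rw [ih]
          simp only [mul_inv]
          field_simp

/-- The function `₂F₁(-λ, λ+1; 1+m; ·)`. -/
noncomputable def legendreU (lam : ℂ) (m : ℕ) (x : ℂ) : ℂ :=
  ∑' n, legendreCoeff lam m n * x ^ n

/-- The companion function `(1 - x) u' + m u` of `u = legendreU lam m`. -/
noncomputable def legendreV (lam : ℂ) (m : ℕ) (x : ℂ) : ℂ :=
  (m - lam) * (m + 1 + lam) / (m + 1) * legendreU lam (m + 1) x

theorem exists_norm_legendreCoeff_le_const {lam : ℂ} (hlam : ∀ n : ℤ, lam ≠ (n : ℂ)) :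
    ∃ K : ℝ, ∀ m n : ℕ, ‖legendreCoeff lam m n‖ ≤ K := by
  obtain ⟨K, hK⟩ := exists_norm_legendreCoeff_le hlam
  refine ⟨K, fun m n => le_trans ?_ (hK m n)⟩
  exact le_mul_of_one_le_left (norm_nonneg _) (le_add_of_nonneg_left n.cast_nonneg)

theorem hasSum_legendreU {lam : ℂ} (hlam : ∀ n : ℤ, lam ≠ (n : ℂ)) (m : ℕ) {x : ℂ}
    (hx : ‖x‖ < 1) : HasSum (fun n => legendreCoeff lam m n * x ^ n) (legendreU lam m x) := by
  obtain ⟨K, hK⟩ := exists_norm_legendreCoeff_le_const hlam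
  exact hasSum_tsum_pow_of_bounded (hK m) hx

theorem exists_hasDerivAt_legendreU {lam : ℂ} (hlam : ∀ n : ℤ, lam ≠ (n : ℂ)) (m : ℕ) {x : ℂ}
    (hx : ‖x‖ < 1) :
    ∃ D, HasDerivAt (legendreU lam m) D x ∧
      HasSum (fun n : ℕ => (n + 1) * legendreCoeff lam m (n + 1) * x ^ n) D ∧
      HasSum (fun n : ℕ => n * legendreCoeff lam m n * x ^ n) (x * D) := by
  obtain ⟨K, hK⟩ := exists_norm_legendreCoeff_le_const hlam
  obtain ⟨D, hD, hs⟩ := hasDerivAt_tsum_pow_of_bounded (hK m) hx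
  refine ⟨D, hD, ?_, ?_⟩
  · have h := (hasSum_nat_add_iff' 1).2 hs
    simp only [Finset.sum_range_one, CharP.cast_eq_zero, zero_mul, mul_zero, sub_zero] at h
    refine h.congr_fun fun n => ?_
    simp only [add_tsub_cancel_right]
    push_cast
    ring
  · refine (hs.mul_left x).congr_fun fun n => ?_
    rcases n with _ | n
    · simp
    · simp only [add_tsub_cancel_right, pow_succ]
      ring

theorem exists_hasDerivAt_legendreU_eq {lam : ℂ} (hlam : ∀ n : ℤ, lam ≠ (n : ℂ)) (m : ℕ)
    {x : ℂ} (hx : ‖x‖ < 1) :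
    ∃ D, HasDerivAt (legendreU lam m) D x ∧
      (1 - x) * D = legendreV lam m x - m * legendreU lam m x := by
  obtain ⟨D, hD, h1, h2⟩ := exists_hasDerivAt_legendreU hlam m hx
  refine ⟨D, hD, ?_⟩
  have h := (h1.sub h2).add ((hasSum_legendreU hlam m hx).mul_left (m : ℂ))
  have h' := (hasSum_legendreU hlam (m + 1) hx).mul_left ((m - lam) * (m + 1 + lam) / (m + 1))
  have : D - x * D + m * legendreU lam m x = legendreV lam m x := by
    refine h.unique (h'.congr_fun fun n => ?_)
    linear_combination x ^ n * legendreCoeff_telescope lam m n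
  linear_combination this

theorem exists_hasDerivAt_legendreV_eq {lam : ℂ} (hlam : ∀ n : ℤ, lam ≠ (n : ℂ)) (m : ℕ)
    {x : ℂ} (hx : ‖x‖ < 1) :
    ∃ D, HasDerivAt (legendreV lam m) D x ∧
      x * D = (m - lam) * (m + 1 + lam) * legendreU lam m x - (m + 1) * legendreV lam m x := by
  obtain ⟨D, hD, -, h2⟩ := exists_hasDerivAt_legendreU hlam (m + 1) hx
  refine ⟨_, hD.const_mul ((m - lam) * (m + 1 + lam) / (m + 1)), ?_⟩
  have h4 : (m : ℂ) + 1 ≠ 0 := by exact_mod_cast m.succ_ne_zero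
  have h := h2.add ((hasSum_legendreU hlam (m + 1) hx).mul_left (m + 1 : ℂ))
  have : x * D + (m + 1) * legendreU lam (m + 1) x = (1 + m) * legendreU lam m x := by
    refine h.unique (((hasSum_legendreU hlam m hx).mul_left (1 + m : ℂ)).congr_fun fun n => ?_)
    linear_combination x ^ n * legendreCoeff_order_succ lam m n
  rw [legendreV]
  field_simp
  linear_combination (m - lam) * (m + 1 + lam) * this

/-- The conserved quantity of the Legendre equation attached to the solutions `u(x)` and
`u(1 - x)`. -/
noncomputable def legendreQ (lam : ℂ) (m : ℕ) (x : ℝ) : ℂ :=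
  (1 - x) * legendreU lam m x * legendreV lam m (1 - x : ℝ) +
    x * legendreV lam m x * legendreU lam m (1 - x : ℝ)

theorem hasDerivAt_legendreQ {lam : ℂ} (hlam : ∀ n : ℤ, lam ≠ (n : ℂ)) (m : ℕ) {x : ℝ}
    (hx : x ∈ Set.Ioo (0 : ℝ) 1) : HasDerivAt (legendreQ lam m) 0 x := by
  have hn : ‖(x : ℂ)‖ < 1 := by
    rw [Complex.norm_of_nonneg hx.1.le]; exact hx.2
  have hn' : ‖((1 - x : ℝ) : ℂ)‖ < 1 := by
    rw [Complex.norm_of_nonneg (by linarith [hx.2])]; linarith [hx.1]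
  obtain ⟨u, hu, eu⟩ := exists_hasDerivAt_legendreU_eq hlam m hn
  obtain ⟨v, hv, ev⟩ := exists_hasDerivAt_legendreV_eq hlam m hn
  obtain ⟨u', hu', eu'⟩ := exists_hasDerivAt_legendreU_eq hlam m hn'
  obtain ⟨v', hv', ev'⟩ := exists_hasDerivAt_legendreV_eq hlam m hn'
  have hid : HasDerivAt (fun y : ℝ => (y : ℂ)) 1 x := Complex.ofRealCLM.hasDerivAt
  have hrefl : HasDerivAt (fun y : ℝ => ((1 - y : ℝ) : ℂ)) (-1) x := by
    simpa using hid.const_sub 1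
  have hU := hu.comp_ofReal
  have hV := hv.comp_ofReal
  have hU' := hu'.comp x hrefl
  have hV' := hv'.comp x hrefl
  refine ((((hid.const_sub 1).mul hU).mul hV').add ((hid.mul hV).mul hU')).congr_deriv ?_
  simp only [Function.comp_apply, Pi.mul_apply]
  push_cast at *
  linear_combination
    legendreV lam m (1 - x) * eu - legendreU lam m x * ev' +
      legendreU lam m (1 - x) * ev - legendreV lam m x * eu'

theorem one_sub_mul_pow_le {y : ℝ} (h0 : 0 ≤ y) (h1 : y ≤ 1) (n : ℕ) :
    (1 - y) * y ^ n ≤ 1 / ((n : ℝ) + 1) := by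
  have hle : (n + 1 : ℝ) * y ^ n ≤ ∑ k ∈ Finset.range (n + 1), y ^ k := by
    have := Finset.card_nsmul_le_sum (Finset.range (n + 1)) (fun k => y ^ k) (y ^ n)
      fun k hk => pow_le_pow_of_le_one h0 h1 (Nat.lt_succ_iff.1 (Finset.mem_range.1 hk))
    simpa using this
  rw [le_div_iff₀ (by positivity)]
  calc (1 - y) * y ^ n * (n + 1) = (1 - y) * ((n + 1) * y ^ n) := by ring
    _ ≤ (1 - y) * ∑ k ∈ Finset.range (n + 1), y ^ k := by gcongr
    _ = 1 - y ^ (n + 1) := mul_neg_geom_sum y (n + 1)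
    _ ≤ 1 := by linarith [pow_nonneg h0 (n + 1)]

theorem tendsto_ofReal_mul_legendreU {lam : ℂ} (hlam : ∀ n : ℤ, lam ≠ (n : ℂ)) (m : ℕ) :
    Tendsto (fun x : ℝ => (x : ℂ) * legendreU lam m (1 - x : ℝ)) (𝓝[>] 0) (𝓝 0) := by
  obtain ⟨K, hK⟩ := exists_norm_legendreCoeff_le hlam
  have hterm (n : ℕ) : Tendsto
      (fun x : ℝ => (x : ℂ) * (legendreCoeff lam m n * ((1 - x : ℝ) : ℂ) ^ n)) (𝓝[>] 0)
      (𝓝 0) := by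
    have hc : Continuous
        fun x : ℝ => (x : ℂ) * (legendreCoeff lam m n * ((1 - x : ℝ) : ℂ) ^ n) := by fun_prop
    simpa using (hc.tendsto 0).mono_left nhdsWithin_le_nhds
  have hlim := tendsto_tsum_of_dominated_convergence
    (summable_one_div_natCast_add_one_sq.mul_left K) hterm (by
      filter_upwards [Ioo_mem_nhdsGT (zero_lt_one' ℝ)] with x hx n
      have hpow := one_sub_mul_pow_le (y := 1 - x) (by linarith [hx.2]) (by linarith [hx.1]) n
      rw [sub_sub_cancel] at hpow
      have hc : ‖legendreCoeff lam m n‖ ≤ K * (1 / ((n : ℝ) + 1)) := by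
        rw [mul_one_div, le_div_iff₀ (by positivity), mul_comm]
        exact hK m n
      rw [norm_mul, norm_mul, norm_pow, Complex.norm_of_nonneg hx.1.le,
        Complex.norm_of_nonneg (by linarith [hx.2])]
      have h1x : (0 : ℝ) ≤ 1 - x := by linarith [hx.2]
      calc x * (‖legendreCoeff lam m n‖ * (1 - x) ^ n)
          = ‖legendreCoeff lam m n‖ * (x * (1 - x) ^ n) := by ring
        _ ≤ K * (1 / ((n : ℝ) + 1)) * (1 / ((n : ℝ) + 1)) :=
          mul_le_mul hc hpow (mul_nonneg hx.1.le (pow_nonneg h1x n)) ((norm_nonneg _).trans hc)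
        _ = K * (1 / ((n : ℝ) + 1) ^ 2) := by field_simp)
  rw [tsum_zero] at hlim
  refine hlim.congr fun x => ?_
  rw [legendreU, tsum_mul_left]

theorem tendsto_legendreV_boundary {lam : ℂ} (hlam : ∀ n : ℤ, lam ≠ (n : ℂ)) (m : ℕ) :
    Tendsto (fun x : ℝ => legendreV lam m (1 - x : ℝ)) (𝓝[>] 0)
      (𝓝 (legendreBoundary lam m)) := by
  refine Tendsto.const_mul _ ?_
  refine tendsto_tsum_of_dominated_convergence (summable_legendreCoeff_succ hlam m)
    (fun n => ?_) ?_
  · have hc : Continuous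
        fun x : ℝ => legendreCoeff lam (m + 1) n * ((1 - x : ℝ) : ℂ) ^ n := by fun_prop
    simpa using (hc.tendsto 0).mono_left nhdsWithin_le_nhds
  · filter_upwards [Ioo_mem_nhdsGT (zero_lt_one' ℝ)] with x hx n
    have h1x : (0 : ℝ) ≤ 1 - x := by linarith [hx.2]
    rw [norm_mul, norm_pow, Complex.norm_of_nonneg h1x]
    exact mul_le_of_le_one_right (norm_nonneg _) (pow_le_one₀ h1x (by linarith [hx.1]))

theorem legendreU_zero (lam : ℂ) (m : ℕ) : legendreU lam m 0 = 1 := by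
  rw [legendreU, tsum_eq_single 0 fun n hn => by rw [zero_pow hn, mul_zero]]
  simp

theorem legendreQ_eq_legendreBoundary {lam : ℂ} (hlam : ∀ n : ℤ, lam ≠ (n : ℂ)) (m : ℕ)
    {x : ℝ} (hx : x ∈ Set.Ioo (0 : ℝ) 1) : legendreQ lam m x = legendreBoundary lam m := by
  have hconst : ∀ y ∈ Set.Ioo (0 : ℝ) 1, legendreQ lam m y = legendreQ lam m x := fun y hy =>
    isOpen_Ioo.is_const_of_deriv_eq_zero isPreconnected_Ioo
      (fun z hz => (hasDerivAt_legendreQ hlam m hz).differentiableAt.differentiableWithinAt)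
      (fun z hz => (hasDerivAt_legendreQ hlam m hz).deriv) hy hx
  have hlim : Tendsto (legendreQ lam m) (𝓝[>] 0) (𝓝 (legendreQ lam m x)) :=
    tendsto_const_nhds.congr' <| by
      filter_upwards [Ioo_mem_nhdsGT (zero_lt_one' ℝ)] with y hy using (hconst y hy).symm
  refine tendsto_nhds_unique hlim ?_
  have h0 : ‖((0 : ℝ) : ℂ)‖ < 1 := by simp
  obtain ⟨_, hu, -⟩ := exists_hasDerivAt_legendreU_eq hlam m h0
  obtain ⟨_, hv, -⟩ := exists_hasDerivAt_legendreV_eq hlam m h0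
  have hU := hu.comp_ofReal.continuousAt.tendsto.mono_left (nhdsWithin_le_nhds (s := Set.Ioi 0))
  have hV := hv.comp_ofReal.continuousAt.tendsto.mono_left (nhdsWithin_le_nhds (s := Set.Ioi 0))
  have hid : Tendsto (fun y : ℝ => 1 - (y : ℂ)) (𝓝[>] 0) (𝓝 1) := by
    have hc : Continuous fun y : ℝ => 1 - (y : ℂ) := by fun_prop
    simpa using (hc.tendsto 0).mono_left nhdsWithin_le_nhds
  have h := ((hid.mul hU).mul (tendsto_legendreV_boundary hlam m)).add
    (hV.mul (tendsto_ofReal_mul_legendreU hlam m))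
  rw [Complex.ofReal_zero, legendreU_zero, mul_zero, add_zero, one_mul, one_mul] at h
  refine h.congr fun y => ?_
  rw [legendreQ]
  ring

theorem legendre_factor_mul_neg {z : ℝ} (hz : z ∈ Set.Ioo (-1 : ℝ) 1) (s : ℂ) :
    ((1 - z) / (1 + z) : ℂ) ^ s * ((1 - (-z : ℝ)) / (1 + (-z : ℝ)) : ℂ) ^ s = 1 := by
  have h1 : 0 < 1 - z := by linarith [hz.2]
  have h2 : 0 < 1 + z := by linarith [hz.1]
  have e1 : ((1 - z) / (1 + z) : ℂ) = (((1 - z) / (1 + z) : ℝ) : ℂ) := by push_cast; rfl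
  have e2 : ((1 - (-z : ℝ)) / (1 + (-z : ℝ)) : ℂ) = (((1 + z) / (1 - z) : ℝ) : ℂ) := by
    push_cast; ring
  rw [e1, e2, ← Complex.mul_cpow_ofReal_nonneg (by positivity) (by positivity),
    ← Complex.ofReal_mul, div_mul_div_comm, mul_comm (1 - z), div_self (by positivity)]
  simp

theorem exists_hasDerivAt_PLeg {lam : ℂ} (hlam : ∀ n : ℤ, lam ≠ (n : ℂ)) (m : ℕ) {z : ℝ}
    (hz : z ∈ Set.Ioo (-1 : ℝ) 1) :
    ∃ D, HasDerivAt (PLeg m lam) D z ∧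
      (1 - (z : ℂ) ^ 2) * D =
        -(((ascPochhammer ℂ m).eval (-lam) * (ascPochhammer ℂ m).eval (1 + lam) /
            (m.factorial : ℂ)) * ((1 - z) / (1 + z) : ℂ) ^ ((m : ℂ) / 2) *
          ((1 - z) * legendreV lam m ((1 - z) / 2 : ℝ) +
            m * z * legendreU lam m ((1 - z) / 2 : ℝ))) := by
  have h1 : 0 < 1 - z := by linarith [hz.2]
  have h2 : 0 < 1 + z := by linarith [hz.1]
  have h1' : (1 - z : ℂ) ≠ 0 := by exact_mod_cast h1.ne.symm
  have h2' : (1 + z : ℂ) ≠ 0 := by exact_mod_cast h2.ne.symm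
  have e1 : ((1 - z) / (1 + z) : ℂ) = (((1 - z) / (1 + z) : ℝ) : ℂ) := by push_cast; rfl
  have hx : ‖(((1 - z) / 2 : ℝ) : ℂ)‖ < 1 := by
    rw [Complex.norm_of_nonneg (by linarith)]; linarith
  obtain ⟨u, hu, eu⟩ := exists_hasDerivAt_legendreU_eq hlam m hx
  have hid : HasDerivAt (fun w : ℂ => w) 1 (z : ℂ) := hasDerivAt_id _
  have hbase := (hid.const_sub 1).div (hid.const_add 1) h2'
  have hslit : ((1 - z) / (1 + z) : ℂ) ∈ Complex.slitPlane := by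
    rw [e1, Complex.ofReal_mem_slitPlane]; positivity
  have hpow := (hbase.cpow_const (c := (m : ℂ) / 2) hslit).comp_ofReal
  have harg : HasDerivAt (fun y : ℝ => (((1 - y) / 2 : ℝ) : ℂ)) (-1 / 2) z := by
    simpa using ((((hasDerivAt_id z).const_sub 1).div_const 2).ofReal_comp)
  have hP := (hpow.const_mul ((ascPochhammer ℂ m).eval (-lam) *
    (ascPochhammer ℂ m).eval (1 + lam) / (m.factorial : ℂ))).mul (hu.comp z harg)
  refine ⟨_, hP, ?_⟩
  simp only [Function.comp_apply, Pi.div_apply, Complex.cpow_sub _ _ (div_ne_zero h1' h2'),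
    Complex.cpow_one]
  generalize ((1 - z) / (1 + z) : ℂ) ^ ((m : ℂ) / 2) = r
  generalize legendreU lam m ((1 - z) / 2 : ℝ) = U at *
  generalize legendreV lam m ((1 - z) / 2 : ℝ) = V at *
  generalize (ascPochhammer ℂ m).eval (-lam) * (ascPochhammer ℂ m).eval (1 + lam) /
    (m.factorial : ℂ) = C
  push_cast at eu
  field_simp
  linear_combination (-2 * C * r * (1 + z) * (1 - z) ^ 2) * eu

theorem PLeg_wronskian_of_hasDerivAt {lam : ℂ} (hlam : ∀ n : ℤ, lam ≠ (n : ℂ)) (m : ℕ) {z : ℝ}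
    (hz : z ∈ Set.Ioo (-1 : ℝ) 1) {D D' : ℂ} (hD : HasDerivAt (PLeg m lam) D z)
    (hD' : HasDerivAt (PLeg m lam) D' (-z)) :
    PLeg m lam z * (-D') - D * PLeg m lam (-z) =
      2 * (1 - (z : ℂ) ^ 2)⁻¹ /
        (Complex.Gamma (lam + 1 - m) * Complex.Gamma (-lam - m)) := by
  have hz' : -z ∈ Set.Ioo (-1 : ℝ) 1 := ⟨by linarith [hz.2], by linarith [hz.1]⟩
  have h1' : (1 - (z : ℂ) ^ 2) ≠ 0 := by
    have : 0 < 1 - z ^ 2 := by nlinarith [hz.1, hz.2]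
    exact_mod_cast this.ne'
  obtain ⟨_, hE, eD⟩ := exists_hasDerivAt_PLeg hlam m hz
  obtain ⟨_, hE', eD'⟩ := exists_hasDerivAt_PLeg hlam m hz'
  rw [hE.unique hD] at eD
  rw [hE'.unique hD'] at eD'
  have hx : (1 - z) / 2 ∈ Set.Ioo (0 : ℝ) 1 := ⟨by linarith [hz.2], by linarith [hz.1]⟩
  have hQ := legendreQ_eq_legendreBoundary hlam m hx
  have hB := ascPochhammer_sq_mul_legendreBoundary hlam m
  have hr := legendre_factor_mul_neg hz ((m : ℂ) / 2)
  have hrefl : 1 - (1 - z) / 2 = (1 - -z) / 2 := by ring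
  have hP (y : ℝ) : PLeg m lam y =
      ((ascPochhammer ℂ m).eval (-lam) * (ascPochhammer ℂ m).eval (1 + lam) /
        (m.factorial : ℂ)) * ((1 - y) / (1 + y) : ℂ) ^ ((m : ℂ) / 2) *
        legendreU lam m ((1 - y) / 2 : ℝ) := rfl
  rw [legendreQ, hrefl] at hQ
  rw [← hQ] at hB
  rw [mul_div_assoc, div_eq_mul_inv, ← hB, hP z, hP (-z)]
  generalize (ascPochhammer ℂ m).eval (-lam) * (ascPochhammer ℂ m).eval (1 + lam) /
    (m.factorial : ℂ) = C at *
  generalize ((1 - z) / (1 + z) : ℂ) ^ ((m : ℂ) / 2) = r at *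
  generalize ((1 - (-z : ℝ)) / (1 + (-z : ℝ)) : ℂ) ^ ((m : ℂ) / 2) = r' at *
  generalize legendreU lam m ((1 - z) / 2 : ℝ) = U at *
  generalize legendreV lam m ((1 - z) / 2 : ℝ) = V at *
  generalize legendreU lam m ((1 - -z) / 2 : ℝ) = U' at *
  generalize legendreV lam m ((1 - -z) / 2 : ℝ) = V' at *
  apply mul_left_cancel₀ h1'
  push_cast at *
  field_simp
  linear_combination (-C * r * U) * eD' - (C * r' * U') * eD +
    C ^ 2 * (U * ((1 + z) * V' - m * z * U') + ((1 - z) * V + m * z * U) * U') * hr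

theorem PLeg_wronskian (m : ℕ) (lam : ℂ) (hlam : ∀ n : ℤ, lam ≠ (n : ℂ)) :
    (∀ z ∈ Set.Ioo (-1 : ℝ) 1,
      PLeg m lam z * deriv (fun x : ℝ => PLeg m lam (-x)) z
        - deriv (fun x : ℝ => PLeg m lam x) z * PLeg m lam (-z)
        = 2 * (1 - (z : ℂ) ^ 2)⁻¹ /
            (Complex.Gamma (lam + 1 - m) * Complex.Gamma (-lam - m))) ∧
    ¬ ∃ c d : ℂ, (c ≠ 0 ∨ d ≠ 0) ∧
      ∀ z ∈ Set.Ioo (-1 : ℝ) 1, c * PLeg m lam z + d * PLeg m lam (-z) = 0 := by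
  have hneg {z : ℝ} (hz : z ∈ Set.Ioo (-1 : ℝ) 1) : -z ∈ Set.Ioo (-1 : ℝ) 1 :=
    ⟨by linarith [hz.2], by linarith [hz.1]⟩
  refine ⟨fun z hz => ?_, ?_⟩
  · obtain ⟨D, hD, -⟩ := exists_hasDerivAt_PLeg hlam m hz
    obtain ⟨D', hD', -⟩ := exists_hasDerivAt_PLeg hlam m (hneg hz)
    rw [deriv_comp_neg (PLeg m lam), hD'.deriv, hD.deriv]
    exact PLeg_wronskian_of_hasDerivAt hlam m hz hD hD'
  · rintro ⟨c, d, hcd, h⟩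
    have h0 : (0 : ℝ) ∈ Set.Ioo (-1 : ℝ) 1 := by norm_num
    obtain ⟨D, hD, -⟩ := exists_hasDerivAt_PLeg hlam m h0
    have hD' : HasDerivAt (PLeg m lam) D (-0) := by rwa [neg_zero]
    have hW := PLeg_wronskian_of_hasDerivAt hlam m h0 hD hD'
    have g1 : Complex.Gamma (lam + 1 - m) ≠ 0 := Complex.Gamma_ne_zero fun k hk =>
      hlam (m - k - 1) (by push_cast; linear_combination hk)
    have g2 : Complex.Gamma (-lam - m) ≠ 0 := Complex.Gamma_ne_zero fun k hk =>
      hlam (k - m) (by push_cast; linear_combination -hk)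
    have hne : PLeg m lam 0 * D ≠ 0 := by
      intro hzero
      have : (2 * (1 - ((0 : ℝ) : ℂ) ^ 2)⁻¹ /
          (Complex.Gamma (lam + 1 - m) * Complex.Gamma (-lam - m))) ≠ 0 :=
        div_ne_zero (by norm_num) (mul_ne_zero g1 g2)
      rw [← hW, neg_zero] at this
      exact this (by linear_combination -2 * hzero)
    have hval := h 0 h0
    rw [neg_zero, ← add_mul] at hval
    have hsum : c + d = 0 := (mul_eq_zero.1 hval).resolve_right (left_ne_zero_of_mul hne)
    have hcomb : HasDerivAt (fun x : ℝ => c * PLeg m lam x + d * PLeg m lam (-x))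
        (c * D + d * -D) 0 :=
      (hD.const_mul c).add (((hD'.scomp 0 (hasDerivAt_neg 0)).congr_deriv (by simp)).const_mul d)
    have hzero : HasDerivAt (fun x : ℝ => c * PLeg m lam x + d * PLeg m lam (-x)) 0 0 :=
      (hasDerivAt_const (0 : ℝ) (0 : ℂ)).congr_of_eventuallyEq <| by
        filter_upwards [isOpen_Ioo.mem_nhds h0] with x hx using h x hx
    have hdiff : (c - d) * D = 0 := by linear_combination hcomb.unique hzero
    have hsub : c - d = 0 := (mul_eq_zero.1 hdiff).resolve_right (right_ne_zero_of_mul hne)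
    have hc : c = 0 := by linear_combination (hsum + hsub) / 2
    have hd : d = 0 := by linear_combination (hsum - hsub) / 2
    exact hcd.elim (fun h => h hc) fun h => h hd
end
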